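/- (Energy lower bound against the circle average, inequality (id1) in Proposition 2.3) Let f : ℝ² → ℝⁿ be smooth, 2π-periodic in θ, and satisfy |∂_t f|² = |∂_θ f|² at every point. Let f*(t) = (1/2π)∫₀^{2π} f(t,θ) dθ be the circle average, regarded as a map on ℝ² independent of θ. Then for every s > 0, ∫_{[−s,s]×[0,2π]} ∇(f − f*) · ∇f ≥ (1/2) ∫_{[−s,s]×[0,2π]} |∇f|². -/

import Mathlib

open MeasureTheory Set Filter
open scoped ENNReal Real RealInnerProductSpace

/-- Partial derivative in the first coordinate direction. -/
noncomputable def pd1 {n : ℕ} (f : ℝ × ℝ → EuclideanSpace ℝ (Fin n)) (z : ℝ × ℝ) :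
    EuclideanSpace ℝ (Fin n) := fderiv ℝ f z (1, 0)

/-- Partial derivative in the second coordinate direction. -/
noncomputable def pd2 {n : ℕ} (f : ℝ × ℝ → EuclideanSpace ℝ (Fin n)) (z : ℝ × ℝ) :
    EuclideanSpace ℝ (Fin n) := fderiv ℝ f z (0, 1)

/-- `|∇f|²`. -/
noncomputable def gradSq {n : ℕ} (f : ℝ × ℝ → EuclideanSpace ℝ (Fin n)) (z : ℝ × ℝ) : ℝ :=
    ‖pd1 f z‖ ^ 2 + ‖pd2 f z‖ ^ 2

/-- The Laplacian `Δf = ∂²f/∂x² + ∂²f/∂y²`. -/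
noncomputable def lap {n : ℕ} (f : ℝ × ℝ → EuclideanSpace ℝ (Fin n)) (z : ℝ × ℝ) :
    EuclideanSpace ℝ (Fin n) := pd1 (pd1 f) z + pd2 (pd2 f) z

/-- The Willmore energy `W(f, Ω) = ∫_{Ω ∩ {∇f ≠ 0}} |Δf|²/|∇f|²`. -/
noncomputable def willmore {n : ℕ} (f : ℝ × ℝ → EuclideanSpace ℝ (Fin n))
    (Ω : Set (ℝ × ℝ)) : ℝ≥0∞ :=
  ∫⁻ z in Ω ∩ {w | gradSq f w ≠ 0}, ENNReal.ofReal (‖lap f z‖ ^ 2 / gradSq f z)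

/-- The circle average `f*(t) = (1/2π) ∫₀^{2π} f(t,θ) dθ`. -/
noncomputable def circAvg {n : ℕ} (f : ℝ × ℝ → EuclideanSpace ℝ (Fin n)) (t : ℝ) :
    EuclideanSpace ℝ (Fin n) := (2 * π)⁻¹ • ∫ θ in (0:ℝ)..(2 * π), f (t, θ)

section CircleAverage

variable {n : ℕ} {f g : ℝ × ℝ → EuclideanSpace ℝ (Fin n)}

theorem continuous_pd1 (hf : ContDiff ℝ 1 f) : Continuous (pd1 f) :=
  (hf.continuous_fderiv one_ne_zero).clm_apply continuous_const

theorem continuous_pd2 (hf : ContDiff ℝ 1 f) : Continuous (pd2 f) :=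
  (hf.continuous_fderiv one_ne_zero).clm_apply continuous_const

theorem continuous_circAvg (hg : Continuous g) : Continuous (circAvg g) :=
  (intervalIntegral.continuous_parametric_intervalIntegral_of_continuous'
    (f := fun t θ => g (t, θ)) hg 0 (2 * π)).const_smul (2 * π)⁻¹

theorem hasDerivAt_circAvg (hf : ContDiff ℝ 1 f) (t : ℝ) :
    HasDerivAt (circAvg f) (circAvg (pd1 f) t) t := by
  have hcont := hf.continuous
  have hpd := continuous_pd1 hf
  obtain ⟨C, hC⟩ := ((isCompact_closedBall t 1).prod
    (isCompact_uIcc (a := (0 : ℝ)) (b := 2 * π))).exists_bound_of_continuousOn hpd.continuousOn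
  refine HasDerivAt.const_smul (2 * π)⁻¹
    (intervalIntegral.hasDerivAt_integral_of_dominated_loc_of_deriv_le
      (F := fun x θ => f (x, θ)) (F' := fun x θ => pd1 f (x, θ)) (bound := fun _ => C)
      (Metric.closedBall_mem_nhds t one_pos)
      (.of_forall fun x => ?_) ?_ ?_ ?_ ?_ ?_).2
  · exact (hcont.comp (by fun_prop : Continuous fun θ : ℝ => (x, θ))).aestronglyMeasurable
  · exact (hcont.comp (by fun_prop : Continuous fun θ : ℝ => (t, θ))).intervalIntegrable _ _
  · exact (hpd.comp (by fun_prop : Continuous fun θ : ℝ => (t, θ))).aestronglyMeasurable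
  · exact .of_forall fun θ hθ x hx => hC (x, θ) ⟨hx, uIoc_subset_uIcc hθ⟩
  · exact intervalIntegrable_const
  · refine .of_forall fun θ _ x _ => ?_
    exact ((hf.differentiable one_ne_zero (x, θ)).hasFDerivAt.comp_hasDerivAt x
      ((hasDerivAt_id x).prodMk (hasDerivAt_const x θ)))

theorem hasFDerivAt_sub_circAvg (hf : ContDiff ℝ 1 f) (z : ℝ × ℝ) :
    HasFDerivAt (fun w => f w - circAvg f w.1)
      (fderiv ℝ f z - (ContinuousLinearMap.toSpanSingleton ℝ (circAvg (pd1 f) z.1)).comp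
        (ContinuousLinearMap.fst ℝ ℝ ℝ)) z :=
  (hf.differentiable one_ne_zero z).hasFDerivAt.sub
    ((hasDerivAt_circAvg hf z.1).hasFDerivAt.comp z hasFDerivAt_fst)

theorem pd1_sub_circAvg (hf : ContDiff ℝ 1 f) (z : ℝ × ℝ) :
    pd1 (fun w => f w - circAvg f w.1) z = pd1 f z - circAvg (pd1 f) z.1 := by
  simp [pd1, (hasFDerivAt_sub_circAvg hf z).fderiv]

theorem pd2_sub_circAvg (hf : ContDiff ℝ 1 f) (z : ℝ × ℝ) :
    pd2 (fun w => f w - circAvg f w.1) z = pd2 f z := by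
  simp [pd2, (hasFDerivAt_sub_circAvg hf z).fderiv]

theorem integral_sub_circAvg (hg : Continuous g) (t : ℝ) :
    ∫ θ in Icc 0 (2 * π), (g (t, θ) - circAvg g t) = 0 := by
  have hgt : Continuous fun θ : ℝ => g (t, θ) := by fun_prop
  rw [integral_Icc_eq_integral_Ioc, ← intervalIntegral.integral_of_le Real.two_pi_pos.le,
    intervalIntegral.integral_sub (hgt.intervalIntegrable _ _) intervalIntegrable_const,
    intervalIntegral.integral_const, circAvg, sub_zero, smul_inv_smul₀ Real.two_pi_pos.ne',
    sub_self]

theorem setIntegral_inner_circAvg_sub (hg : Continuous g) (s : ℝ) :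
    ∫ z in Icc (-s) s ×ˢ Icc 0 (2 * π), ⟪circAvg g z.1, g z - circAvg g z.1⟫ = 0 := by
  have hc := continuous_circAvg hg
  have hcont : Continuous fun z : ℝ × ℝ => ⟪circAvg g z.1, g z - circAvg g z.1⟫ := by fun_prop
  rw [Measure.volume_eq_prod, setIntegral_prod _
    (hcont.continuousOn.integrableOn_compact (isCompact_Icc.prod isCompact_Icc))]
  refine integral_eq_zero_of_ae (.of_forall fun t => ?_)
  have hct : Continuous fun θ : ℝ => g (t, θ) - circAvg g t := by fun_prop
  simp only [Pi.zero_apply]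
  rw [integral_inner (hct.continuousOn.integrableOn_compact isCompact_Icc),
    integral_sub_circAvg hg, inner_zero_right]

end CircleAverage

/-- Energy lower bound against the circle average (inequality (id1) in Proposition 2.3). -/
theorem energy_lower_bound_circle_average (n : ℕ)
    (f : ℝ × ℝ → EuclideanSpace ℝ (Fin n))
    (hsm : ContDiff ℝ (⊤ : ℕ∞) f)
    (hper : ∀ t θ : ℝ, f (t, θ + 2 * π) = f (t, θ))
    (hconf : ∀ z, ‖pd1 f z‖ ^ 2 = ‖pd2 f z‖ ^ 2) :
    ∀ s : ℝ, 0 < s →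
      (1/2) * (∫ z in Icc (-s) s ×ˢ Icc 0 (2 * π), gradSq f z) ≤
        ∫ z in Icc (-s) s ×ˢ Icc 0 (2 * π),
          (⟪pd1 (fun w => f w - circAvg f w.1) z, pd1 f z⟫ +
           ⟪pd2 (fun w => f w - circAvg f w.1) z, pd2 f z⟫) := by
  intro s _
  have hf : ContDiff ℝ 1 f := hsm.of_le (by exact_mod_cast le_top)
  have hp1 := continuous_pd1 hf
  have hp2 := continuous_pd2 hf
  have hc := continuous_circAvg hp1
  have hK : IsCompact (Icc (-s) s ×ˢ Icc 0 (2 * π)) := isCompact_Icc.prod isCompact_Icc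
  have hgrad : Continuous (gradSq f) := by unfold gradSq; fun_prop
  have hinner : Continuous fun z : ℝ × ℝ =>
      ⟪circAvg (pd1 f) z.1, pd1 f z - circAvg (pd1 f) z.1⟫ := by fun_prop
  have hsum : Continuous fun z : ℝ × ℝ =>
      ⟪pd1 f z - circAvg (pd1 f) z.1, pd1 f z⟫ + ⟪pd2 f z, pd2 f z⟫ := by fun_prop
  simp only [pd1_sub_circAvg hf, pd2_sub_circAvg hf]
  have hhalf : Continuous fun z => (1 / 2) * gradSq f z := by fun_prop
  have hadd := integral_add (hhalf.continuousOn.integrableOn_compact (μ := volume) hK)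
    (hinner.continuousOn.integrableOn_compact hK)
  rw [setIntegral_inner_circAvg_sub hp1, add_zero, integral_const_mul] at hadd
  rw [← hadd]
  refine setIntegral_mono
    ((hhalf.add hinner).continuousOn.integrableOn_compact hK)
    (hsum.continuousOn.integrableOn_compact hK) fun z => ?_
  have hsq := real_inner_self_nonneg (x := pd1 f z - circAvg (pd1 f) z.1)
  have hz := hconf z
  simp only [gradSq, ← real_inner_self_eq_norm_sq, inner_sub_left, inner_sub_right] at hsq hz ⊢
  rw [real_inner_comm (circAvg (pd1 f) z.1) (pd1 f z)] at *
  linarith
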